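/- Fix a positive integer N, set ε = 1/N, and for 0 ≤ i ≤ N set θ_i = i·ε·π/4. Fix integers i, j with 1 ≤ i ≤ N and 1 ≤ j ≤ N². For a positive integer n, let T_{ij}(n) be the set of triples (k, r, s) of positive integers with k odd, r > s, gcd(r, s) = 1, r and s of opposite parity, (j−1)·ε·√n < k·(r² + s²) ≤ j·ε·√n, and tan(θ_{i−1}) < s/r ≤ tan(θ_i). Then |T_{ij}(n)| ∼ (ε²/(8π))·√n·log n as n → ∞, i.e. |T_{ij}(n)| / ((ε²/(8π))·√n·log n) → 1; in particular the asymptotic size does not depend on i and j. -/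

import Mathlib

open Filter Real

section Counting

open MeasureTheory Set Topology
open scoped ArithmeticFunction.Moebius

theorem tendsto_card_span_inter_div (v : Fin 2 → Fin 2 → ℝ) (hv : (Matrix.of v).det ≠ 0)
    {X : Set (Fin 2 → ℝ)} (hX : ∀ ⦃x⦄ ⦃r : ℝ⦄, x ∈ X → 0 < r → r • x ∈ X)
    (hm : MeasurableSet X)
    (hc : Convex ℝ X) :
    Tendsto (fun c : ℝ ↦ (Nat.card ({x ∈ X | x 0 ^ 2 + x 1 ^ 2 ≤ c} ∩
        (Submodule.span ℤ (range v) : Submodule ℤ (Fin 2 → ℝ)) : Set (Fin 2 → ℝ)) : ℝ) / c) atTop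
      (𝓝 (volume.real {x ∈ X | x 0 ^ 2 + x 1 ^ 2 ≤ 1} / |(Matrix.of v).det|)) := by
  have hli := Matrix.linearIndependent_rows_of_det_ne_zero hv
  obtain ⟨b, hb⟩ : ∃ b : Module.Basis (Fin 2) ℝ (Fin 2 → ℝ), ⇑b = v :=
    ⟨basisOfLinearIndependentOfCardEqFinrank hli (by simp),
      coe_basisOfLinearIndependentOfCardEqFinrank _ _⟩
  have hdet : |(Matrix.of v).det| = ZLattice.covolume (Submodule.span ℤ (range b)) := by
    rw [ZLattice.covolume_eq_det _ (b.restrictScalars ℤ)]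
    congr 2
    ext i j
    simp [hb]
  rw [hdet, ← hb]
  have hball : Convex ℝ {x : Fin 2 → ℝ | x 0 ^ 2 + x 1 ^ 2 ≤ 1} := by
    intro x hx y hy a b ha hb hab
    simp only [mem_ofPred_eq, Pi.add_apply, Pi.smul_apply, smul_eq_mul] at *
    obtain rfl : b = 1 - a := by linarith
    nlinarith [mul_nonneg ha hb, mul_nonneg (mul_nonneg ha hb) (sq_nonneg (x 0 - y 0)), mul_nonneg (mul_nonneg ha hb) (sq_nonneg (x 1 - y 1))]
  have hconv : Convex ℝ {x | x ∈ X ∧ x 0 ^ 2 + x 1 ^ 2 ≤ 1} := hc.inter hball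
  refine ZLattice.covolume.tendsto_card_le_div (Submodule.span ℤ (range b)) hX
    (F := fun x ↦ x 0 ^ 2 + x 1 ^ 2) ?_ ?_ ?_ ?_
  · intro x r hr
    simp
    ring
  · refine (Metric.isBounded_closedBall (x := (0 : Fin 2 → ℝ)) (r := 1)).subset fun x hx ↦ ?_
    rw [mem_closedBall_zero_iff, pi_norm_le_iff_of_nonneg zero_le_one]
    intro i
    have := hx.2
    rw [Real.norm_eq_abs, abs_le_one_iff_mul_self_le_one]
    fin_cases i <;> simp only [Fin.zero_eta, Fin.mk_one] <;> nlinarith [sq_nonneg (x 0), sq_nonneg (x 1)]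
  · exact hm.inter (show MeasurableSet {x : Fin 2 → ℝ | x 0 ^ 2 + x 1 ^ 2 ≤ 1} by measurability)
  · exact hconv.addHaar_frontier _

/-- The open-closed angular sector. -/
def sector (t₀ t₁ : ℝ) : Set (Fin 2 → ℝ) := {x | 0 < x 0 ∧ t₀ * x 0 < x 1 ∧ x 1 ≤ t₁ * x 0}

theorem volume_sector {a b : ℝ} (ha : 0 ≤ a) (hab : a ≤ b) (hb : b < π / 2) :
    volume.real {x ∈ sector (tan a) (tan b) | x 0 ^ 2 + x 1 ^ 2 ≤ 1} = (b - a) / 2 := by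
  set S : Set (ℝ × ℝ) := {p | (0 < p.1 ∧ tan a * p.1 < p.2 ∧ p.2 ≤ tan b * p.1) ∧
    p.1 ^ 2 + p.2 ^ 2 ≤ 1} with hS
  have hSm : MeasurableSet S := by
    measurability
  have h1 : volume {x ∈ sector (tan a) (tan b) | x 0 ^ 2 + x 1 ^ 2 ≤ 1} = volume S :=
    (volume_preserving_finTwoArrow ℝ).measure_preimage hSm.nullMeasurableSet
  have h2 : volume S = ∫⁻ p, S.indicator 1 p := by rw [lintegral_indicator_one hSm]
  rw [← lintegral_comp_polarCoord_symm] at h2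
  have h3 : ∫⁻ p in polarCoord.target, ENNReal.ofReal p.1 • S.indicator 1 (polarCoord.symm p) =
      ∫⁻ p in Ioc (0 : ℝ) 1 ×ˢ Ioc a b, ENNReal.ofReal p.1 := by
    have hsub : Ioc (0 : ℝ) 1 ×ˢ Ioc a b ⊆ polarCoord.target := by
      rintro ⟨r, θ⟩ ⟨hr, hθ⟩
      simp only [polarCoord_target, mem_prod, mem_Ioi, mem_Ioo, mem_Ioc] at *
      refine ⟨hr.1, by linarith [pi_pos], by linarith [pi_pos]⟩
    rw [← inter_eq_self_of_subset_left hsub, ← Measure.restrict_restrict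
      (measurableSet_Ioc.prod measurableSet_Ioc), ← lintegral_indicator
      (measurableSet_Ioc.prod measurableSet_Ioc)]
    refine setLIntegral_congr_fun polarCoord.open_target.measurableSet ?_
    rintro ⟨r, θ⟩ hp
    simp only [polarCoord_target, mem_prod, mem_Ioi, mem_Ioo] at hp
    obtain ⟨hr, hθ1, hθ2⟩ := hp
    have key : polarCoord.symm (r, θ) ∈ S ↔ (r, θ) ∈ Ioc (0 : ℝ) 1 ×ˢ Ioc a b := by
      simp only [polarCoord_symm_apply, hS, mem_ofPred_eq, mem_prod, mem_Ioc]
      have e1 : (r * cos θ) ^ 2 + (r * sin θ) ^ 2 = r ^ 2 := by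
        linear_combination r ^ 2 * sin_sq_add_cos_sq θ
      rw [e1, mul_pos_iff_of_pos_left hr, sq_le_one_iff₀ hr.le]
      have e2 : 0 < cos θ → ((tan a * (r * cos θ) < r * sin θ ∧ r * sin θ ≤ tan b * (r * cos θ)) ↔
          tan a < tan θ ∧ tan θ ≤ tan b) := by
        intro hc
        rw [tan_eq_sin_div_cos θ, lt_div_iff₀ hc, div_le_iff₀ hc, mul_left_comm,
          mul_lt_mul_iff_right₀ hr, mul_left_comm, mul_le_mul_iff_right₀ hr]
      have hI : ∀ {x}, a ≤ x → x ≤ b → x ∈ Ioo (-(π / 2)) (π / 2) := fun h h' ↦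
        ⟨by linarith [pi_pos], by linarith⟩
      constructor
      · rintro ⟨⟨hc, h⟩, hr1⟩
        rw [e2 hc] at h
        have hθ : θ ∈ Ioo (-(π / 2)) (π / 2) := by
          constructor
          · by_contra! h
            have := cos_nonpos_of_pi_div_two_le_of_le (x := -θ) (by linarith) (by linarith)
            rw [cos_neg] at this
            linarith
          · by_contra! h
            have := cos_nonpos_of_pi_div_two_le_of_le (x := θ) (by linarith) (by linarith)
            linarith
        exact ⟨⟨hr, hr1⟩, (strictMonoOn_tan.lt_iff_lt (hI le_rfl hab) hθ).1 h.1,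
          (strictMonoOn_tan.le_iff_le hθ (hI hab le_rfl)).1 h.2⟩
      · rintro ⟨⟨-, hr1⟩, h1, h2⟩
        have hθ := hI h1.le h2
        have hc := cos_pos_of_mem_Ioo hθ
        refine ⟨⟨hc, (e2 hc).2 ⟨(strictMonoOn_tan.lt_iff_lt (hI le_rfl hab) hθ).2 h1,
          (strictMonoOn_tan.le_iff_le hθ (hI hab le_rfl)).2 h2⟩⟩, hr1⟩
    show ENNReal.ofReal r • S.indicator 1 (polarCoord.symm (r, θ)) = _
    by_cases h : (r, θ) ∈ Ioc (0 : ℝ) 1 ×ˢ Ioc a b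
    · rw [indicator_of_mem h, indicator_of_mem (key.2 h)]
      simp
    · simp only [indicator_of_notMem h, indicator_of_notMem (mt key.1 h), smul_zero]
  have h4 : ∫⁻ p in Ioc (0 : ℝ) 1 ×ˢ Ioc a b, ENNReal.ofReal p.1 = ENNReal.ofReal ((b - a) / 2) := by
    rw [Measure.volume_eq_prod, ← Measure.prod_restrict, lintegral_prod _ (by fun_prop)]
    simp only [lintegral_const, Measure.restrict_apply_univ, Real.volume_Ioc]
    rw [lintegral_mul_const _ (by fun_prop), ← ofReal_integral_eq_lintegral_ofReal,
      ← intervalIntegral.integral_of_le zero_le_one, integral_id, ← ENNReal.ofReal_mul (by norm_num)]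
    · congr 1
      ring
    · exact (continuous_id.integrableOn_Icc).mono_set Ioc_subset_Icc_self
    · exact (ae_restrict_iff' measurableSet_Ioc).2 (.of_forall fun x hx ↦ hx.1.le)
  rw [measureReal_def, h1, h2, h3, h4, ENNReal.toReal_ofReal (by linarith)]

theorem tendsto_card_sector_div (v : Fin 2 → Fin 2 → ℝ) (hv : (Matrix.of v).det ≠ 0)
    {a b : ℝ} (ha : 0 ≤ a) (hab : a ≤ b) (hb : b < π / 2) :
    Tendsto (fun c : ℝ ↦ (Nat.card ({x ∈ sector (tan a) (tan b) | x 0 ^ 2 + x 1 ^ 2 ≤ c} ∩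
        (Submodule.span ℤ (range v) : Submodule ℤ (Fin 2 → ℝ)) : Set (Fin 2 → ℝ)) : ℝ) / c) atTop
      (𝓝 ((b - a) / 2 / |(Matrix.of v).det|)) := by
  rw [← volume_sector ha hab hb]
  refine tendsto_card_span_inter_div v hv ?_ ?_ ?_
  · rintro x r ⟨h1, h2, h3⟩ hr
    refine ⟨mul_pos hr h1, ?_, ?_⟩ <;> simp only [Pi.smul_apply, smul_eq_mul] <;> nlinarith
  · unfold sector
    measurability
  · intro x hx y hy u v hu hv huv
    obtain ⟨h1, h2, h3⟩ := hx
    obtain ⟨k1, k2, k3⟩ := hy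
    obtain rfl : v = 1 - u := by linarith
    refine ⟨?_, ?_, ?_⟩ <;> simp only [Pi.add_apply, Pi.smul_apply, smul_eq_mul]
    · rcases hu.eq_or_lt with rfl | hu
      · simpa
      · nlinarith [mul_pos hu h1, mul_nonneg hv k1.le]
    · rcases hu.eq_or_lt with rfl | hu
      · simpa
      · nlinarith [mul_lt_mul_of_pos_left h2 hu, mul_le_mul_of_nonneg_left k2.le hv]
    · nlinarith [mul_le_mul_of_nonneg_left h3 hu, mul_le_mul_of_nonneg_left k3 hv]

/-- The number of pairs in `P` whose sum of squares is at most `Y`. -/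
noncomputable def pairCount (P : Set (ℕ × ℕ)) (Y : ℝ) : ℕ :=
  {p ∈ P | (p.1 : ℝ) ^ 2 + (p.2 : ℝ) ^ 2 ≤ Y}.ncard

theorem finite_sq_add_sq_le (P : Set (ℕ × ℕ)) (Y : ℝ) :
    {p ∈ P | (p.1 : ℝ) ^ 2 + (p.2 : ℝ) ^ 2 ≤ Y}.Finite := by
  refine ((finite_Iic ⌊Y⌋₊).prod (finite_Iic ⌊Y⌋₊)).subset ?_
  rintro ⟨r, s⟩ ⟨-, h⟩
  have hsq : ∀ n : ℕ, (n : ℝ) ≤ (n : ℝ) ^ 2 := fun n ↦ by exact_mod_cast Nat.le_self_pow two_ne_zero n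
  simp only at h
  constructor
  · exact Nat.le_floor (by nlinarith [hsq r, sq_nonneg (s : ℝ)])
  · exact Nat.le_floor (by nlinarith [hsq s, sq_nonneg (r : ℝ)])

theorem pairCount_le {P : Set (ℕ × ℕ)} (hP : ∀ p ∈ P, 0 < p.1 ∧ 0 < p.2) {Y : ℝ} (hY : 0 ≤ Y) :
    (pairCount P Y : ℝ) ≤ Y := by
  have hsub : {p ∈ P | (p.1 : ℝ) ^ 2 + (p.2 : ℝ) ^ 2 ≤ Y} ⊆
      ((Finset.Icc 1 ⌊√Y⌋₊ ×ˢ Finset.Icc 1 ⌊√Y⌋₊ : Finset (ℕ × ℕ)) : Set (ℕ × ℕ)) := by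
    rintro ⟨r, s⟩ ⟨hp, h⟩
    obtain ⟨h1, h2⟩ := hP _ hp
    simp only [Finset.coe_product, Finset.coe_Icc, mem_prod, mem_Icc] at *
    refine ⟨⟨h1, Nat.le_floor (Real.le_sqrt_of_sq_le ?_)⟩,
      ⟨h2, Nat.le_floor (Real.le_sqrt_of_sq_le ?_)⟩⟩
    · nlinarith [sq_nonneg (s : ℝ)]
    · nlinarith [sq_nonneg (r : ℝ)]
  have h := ncard_le_ncard hsub (Finset.finite_toSet _)
  rw [ncard_coe_finset] at h
  simp only [Finset.card_product, Nat.card_Icc, add_tsub_cancel_right] at h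
  calc (pairCount P Y : ℝ) ≤ (⌊√Y⌋₊ * ⌊√Y⌋₊ : ℕ) := Nat.cast_le.2 h
    _ ≤ √Y * √Y := by
      push_cast
      have := Nat.floor_le (sqrt_nonneg Y)
      gcongr
    _ = Y := mul_self_sqrt hY

theorem pairCount_eq_zero {P : Set (ℕ × ℕ)} (hP : ∀ p ∈ P, 0 < p.1 ∧ 0 < p.2) {Y : ℝ}
    (hY : Y < 1) : pairCount P Y = 0 := by
  rw [pairCount, ncard_eq_zero (finite_sq_add_sq_le P Y), eq_empty_iff_forall_notMem]
  rintro ⟨r, s⟩ ⟨hp, h⟩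
  have h1 : (1 : ℝ) ≤ r := by exact_mod_cast (hP _ hp).1
  simp only at h
  nlinarith [sq_nonneg (s : ℝ)]

theorem pairCount_inter_add_diff (P R : Set (ℕ × ℕ)) (Y : ℝ) :
    pairCount (P ∩ R) Y + pairCount (P \ R) Y = pairCount P Y := by
  rw [pairCount, pairCount, pairCount, ← ncard_union_eq _
    (finite_sq_add_sq_le _ _) (finite_sq_add_sq_le _ _)]
  · congr 1
    ext p
    simp only [mem_union, mem_ofPred_eq, mem_inter_iff, Set.mem_sdiff]
    tauto
  · rw [Set.disjoint_left]
    rintro p ⟨hp, -⟩ ⟨hq, -⟩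
    exact hq.2 hp.2

/-- The pairs of naturals lying in an angular sector. -/
def sectorPairs (t₀ t₁ : ℝ) : Set (ℕ × ℕ) :=
  {p | 0 < p.1 ∧ t₀ * p.1 < p.2 ∧ (p.2 : ℝ) ≤ t₁ * p.1}

theorem sectorPairs_pos {t₀ t₁ : ℝ} (h₀ : 0 ≤ t₀) : ∀ p ∈ sectorPairs t₀ t₁, 0 < p.1 ∧ 0 < p.2 := by
  rintro ⟨r, s⟩ ⟨h1, h2, -⟩
  refine ⟨h1, ?_⟩
  have : (0 : ℝ) < s := lt_of_le_of_lt (by positivity) h2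
  exact_mod_cast this

/-- Pairs of equal parity. -/
def sameParity : Set (ℕ × ℕ) := {p | p.1 % 2 = p.2 % 2}

theorem card_sector_inter_span {t₀ t₁ Y : ℝ} (h₀ : 0 ≤ t₀) (v : Fin 2 → Fin 2 → ℝ)
    (R : Set (ℕ × ℕ))
    (hR : ∀ x : Fin 2 → ℝ, 0 < x 0 → 0 < x 1 → (x ∈ Submodule.span ℤ (range v) ↔
      ∃ p ∈ R, (p.1 : ℝ) = x 0 ∧ (p.2 : ℝ) = x 1)) :
    Nat.card ({x ∈ sector t₀ t₁ | x 0 ^ 2 + x 1 ^ 2 ≤ Y} ∩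
        (Submodule.span ℤ (range v) : Submodule ℤ (Fin 2 → ℝ)) : Set (Fin 2 → ℝ)) =
      pairCount (sectorPairs t₀ t₁ ∩ R) Y := by
  have hinj : Function.Injective (fun p : ℕ × ℕ ↦ (![(p.1 : ℝ), (p.2 : ℝ)] : Fin 2 → ℝ)) := by
    rintro ⟨a, b⟩ ⟨c, d⟩ h
    have h0 := congrFun h 0
    have h1 := congrFun h 1
    simp at h0 h1
    rw [h0, h1]
  rw [pairCount, ← ncard_image_of_injective _ hinj, Nat.card_coe_set_eq]
  congr 1
  ext x
  constructor
  · rintro ⟨⟨⟨h1, h2, h3⟩, h4⟩, h5⟩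
    obtain ⟨p, hp, e0, e1⟩ := (hR x h1 (lt_of_le_of_lt (by positivity) h2)).1 h5
    rw [← e0] at h1 h2 h3 h4
    rw [← e1] at h2 h3 h4
    refine ⟨p, ⟨⟨⟨by exact_mod_cast h1, h2, h3⟩, hp⟩, h4⟩, ?_⟩
    ext i
    fin_cases i <;> simp [e0, e1]
  · rintro ⟨p, ⟨⟨hs, hp⟩, h4⟩, rfl⟩
    have hpos := sectorPairs_pos h₀ p hs
    refine ⟨⟨⟨by simpa using hpos.1, by simpa using hs.2.1, by simpa using hs.2.2⟩, by simpa using h4⟩,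
      (hR _ (by simpa using hpos.1) (by simpa using hpos.2)).2 ⟨p, hp, by simp, by simp⟩⟩

theorem tendsto_pairCount_oppositeParity {a b : ℝ} (ha : 0 ≤ a) (hab : a ≤ b) (hb : b < π / 2) :
    Tendsto (fun Y : ℝ ↦ (pairCount (sectorPairs (tan a) (tan b) \ sameParity) Y : ℝ) / Y) atTop
      (𝓝 ((b - a) / 4)) := by
  have h₀ : 0 ≤ tan a := tan_nonneg_of_nonneg_of_le_pi_div_two ha (by linarith)
  have h1 := tendsto_card_sector_div ![![1, 0], ![0, 1]] (by simp [Matrix.det_fin_two]) ha hab hb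
  have h2 := tendsto_card_sector_div ![![1, 1], ![1, -1]] (by norm_num [Matrix.det_fin_two]) ha hab hb
  simp_rw [card_sector_inter_span h₀ ![![1, 0], ![0, 1]] univ (fun x hx hy ↦ by
    rw [Submodule.mem_span_range_iff_exists_fun]
    simp only [Fin.sum_univ_two, mem_univ, true_and, Prod.exists]
    constructor
    · rintro ⟨c, rfl⟩
      simp at hx hy ⊢
      lift c 0 to ℕ using hx.le with u hu
      lift c 1 to ℕ using hy.le with v hv
      exact ⟨⟨u, by simp⟩, ⟨v, by simp⟩⟩
    · rintro ⟨u, v, h⟩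
      refine ⟨![u, v], ?_⟩
      ext i
      fin_cases i <;> simp [h])] at h1
  simp_rw [card_sector_inter_span h₀ ![![1, 1], ![1, -1]] sameParity (fun x hx hy ↦ by
    rw [Submodule.mem_span_range_iff_exists_fun]
    simp only [Fin.sum_univ_two, sameParity, mem_ofPred_eq, Prod.exists]
    constructor
    · rintro ⟨c, rfl⟩
      simp at hx hy ⊢
      have hx' : 0 < c 0 + c 1 := by exact_mod_cast hx
      have hy' : c 1 < c 0 := by exact_mod_cast hy
      refine ⟨(c 0 + c 1).toNat, (c 0 + -c 1).toNat, by omega, ?_, ?_⟩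
      · exact_mod_cast Int.toNat_of_nonneg (by omega)
      · exact_mod_cast Int.toNat_of_nonneg (by omega)
    · rintro ⟨u, v, h, h0, h1⟩
      obtain ⟨m, hm⟩ : ∃ m : ℤ, (u : ℤ) - v = 2 * m := ⟨((u : ℤ) - v) / 2, by omega⟩
      have hm' : (u : ℝ) - v = 2 * m := by exact_mod_cast hm
      refine ⟨![v + m, m], ?_⟩
      ext i
      fin_cases i <;> simp [← h0, ← h1] <;> linarith)] at h2
  have h3 := h1.sub h2
  convert h3 using 2 with Y
  · rw [← sub_div, inter_univ, ← pairCount_inter_add_diff (sectorPairs (tan a) (tan b)) sameParity]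
    push_cast
    ring
  · norm_num [Matrix.det_fin_two]
    ring

theorem sum_divisors_moebius (n : ℕ) : ∑ d ∈ n.divisors, μ d = if n = 1 then 1 else 0 := by
  rw [← ArithmeticFunction.coe_mul_zeta_apply, ArithmeticFunction.moebius_mul_coe_zeta,
    ArithmeticFunction.one_apply]

/-- The Möbius function restricted to odd integers. -/
noncomputable def oddMoebius (d : ℕ) : ℝ := if Odd d then (μ d : ℝ) else 0

theorem abs_oddMoebius_le_one (d : ℕ) : |oddMoebius d| ≤ 1 := by
  unfold oddMoebius
  split_ifs
  · exact_mod_cast ArithmeticFunction.abs_moebius_le_one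
  · simp

theorem tsum_oddMoebius_div_sq : ∑' d : ℕ, oddMoebius d / (d : ℝ) ^ 2 = 8 / π ^ 2 := by
  have hχ : ∀ n : ℕ, (1 : DirichletCharacter ℂ 2) n = if Odd n then 1 else 0 := by
    intro n
    split_ifs with h
    · exact MulChar.one_apply ((ZMod.isUnit_iff_coprime n 2).2 (Nat.coprime_two_right.2 h))
    · exact MulChar.map_nonunit _ (by rwa [ZMod.isUnit_iff_coprime, Nat.coprime_two_right])
  have h1 := DirichletCharacter.LSeries.mul_mu_eq_one (1 : DirichletCharacter ℂ 2) (s := 2) (by simp)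
  have h2 := DirichletCharacter.LFunctionTrivChar_eq_mul_riemannZeta (N := 2) (s := 2) (by norm_num)
  rw [DirichletCharacter.LFunctionTrivChar, DirichletCharacter.LFunction_eq_LSeries _ (by simp),
    riemannZeta_two, Nat.Prime.primeFactors Nat.prime_two, Finset.prod_singleton] at h2
  rw [h2] at h1
  have h3 : LSeries ((fun n : ℕ ↦ (1 : DirichletCharacter ℂ 2) n) * fun n ↦ (μ n : ℂ)) 2 =
      ((∑' d : ℕ, oddMoebius d / (d : ℝ) ^ 2 : ℝ) : ℂ) := by
    rw [LSeries, Complex.ofReal_tsum]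
    refine tsum_congr fun n ↦ ?_
    rcases eq_or_ne n 0 with rfl | hn
    · simp [oddMoebius]
    · rw [LSeries.term_of_ne_zero hn, Pi.mul_apply, hχ, oddMoebius, Complex.cpow_ofNat]
      split_ifs <;> simp
  rw [h3] at h1
  have h4 : (1 - ((2 : ℕ) : ℂ) ^ (-2 : ℂ)) = ((3 / 4 : ℝ) : ℂ) := by
    rw [Complex.cpow_neg, Complex.cpow_ofNat]
    norm_num
  rw [h4] at h1
  have h5 : (3 / 4 : ℝ) * (π ^ 2 / 6) * ∑' d : ℕ, oddMoebius d / (d : ℝ) ^ 2 = 1 := by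
    exact_mod_cast h1
  rw [eq_div_iff (by positivity)]
  linarith

theorem pairCount_coprime {Q : Set (ℕ × ℕ)} (hQ : ∀ p ∈ Q, 0 < p.1 ∧ 0 < p.2)
    (hodd : ∀ d a b, Odd d → ((d * a, d * b) ∈ Q ↔ (a, b) ∈ Q))
    (heven : ∀ d a b, ¬ Odd d → (d * a, d * b) ∉ Q) {Y : ℝ} (hY : 0 ≤ Y) :
    (pairCount (Q ∩ {p | Nat.Coprime p.1 p.2}) Y : ℝ) =
      ∑' d : ℕ, oddMoebius d * pairCount Q (Y / (d : ℝ) ^ 2) := by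
  classical
  have hzero : ∀ d ∉ Finset.range (⌊Y⌋₊ + 1),
      oddMoebius d * pairCount Q (Y / (d : ℝ) ^ 2) = 0 := by
    intro d hd
    rw [Finset.mem_range, not_lt, Nat.add_one_le_iff, Nat.floor_lt hY] at hd
    have hd1 : (1 : ℝ) ≤ d := by
      have : 0 < d := by exact_mod_cast hY.trans_lt hd
      exact_mod_cast this
    rw [pairCount_eq_zero hQ, Nat.cast_zero, mul_zero]
    rw [div_lt_one (by positivity)]
    nlinarith
  rw [tsum_eq_sum hzero]
  set S := (finite_sq_add_sq_le Q Y).toFinset with hS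
  have hmem : ∀ p, p ∈ S ↔ p ∈ Q ∧ (p.1 : ℝ) ^ 2 + (p.2 : ℝ) ^ 2 ≤ Y := by simp [hS]
  have hterm : ∀ d, oddMoebius d * pairCount Q (Y / (d : ℝ) ^ 2) =
      ∑ p ∈ S, if d ∣ Nat.gcd p.1 p.2 then (μ d : ℝ) else 0 := by
    intro d
    rw [← Finset.sum_filter, Finset.sum_const, nsmul_eq_mul, mul_comm (_ : ℝ) (μ d : ℝ), oddMoebius]
    split_ifs with hd
    · congr 2
      have hd0 : 0 < d := hd.pos
      have hd0' : (0 : ℝ) < d := by exact_mod_cast hd0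
      have hinj : Function.Injective (fun p : ℕ × ℕ ↦ (d * p.1, d * p.2)) := by
        rintro ⟨a, b⟩ ⟨a', b'⟩ h
        simpa [hd0.ne'] using h
      rw [pairCount, ← ncard_image_of_injective _ hinj, ← ncard_coe_finset]
      congr 1
      ext ⟨r, s⟩
      simp only [Finset.coe_filter, hmem, mem_image, mem_ofPred_eq, Prod.mk.injEq, Prod.exists,
        Nat.dvd_gcd_iff, le_div_iff₀ (pow_pos hd0' 2)]
      constructor
      · rintro ⟨a, b, ⟨h, h'⟩, rfl, rfl⟩
        refine ⟨⟨(hodd d a b hd).2 h, ?_⟩, dvd_mul_right _ _, dvd_mul_right _ _⟩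
        push_cast
        linarith
      · rintro ⟨⟨h, h'⟩, ⟨a, rfl⟩, b, rfl⟩
        refine ⟨a, b, ⟨(hodd d a b hd).1 h, ?_⟩, rfl, rfl⟩
        push_cast at h'
        linarith
    · rw [Finset.filter_false_of_mem, Finset.card_empty]
      · simp
      · rintro ⟨r, s⟩ hp hdvd
        rw [Nat.dvd_gcd_iff] at hdvd
        obtain ⟨⟨a, ha⟩, b, hb⟩ := hdvd
        simp only at ha hb
        rw [hmem, ha, hb] at hp
        exact heven d a b hd hp.1
  simp_rw [hterm]
  rw [Finset.sum_comm]
  have hcount : (pairCount (Q ∩ {p | Nat.Coprime p.1 p.2}) Y : ℝ) =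
      ∑ p ∈ S, if Nat.gcd p.1 p.2 = 1 then (1 : ℝ) else 0 := by
    rw [Finset.sum_boole, pairCount, ← ncard_coe_finset]
    congr 2
    ext p
    simp only [Finset.coe_filter, hmem, mem_inter_iff, mem_ofPred_eq, Nat.Coprime]
    tauto
  rw [hcount]
  refine Finset.sum_congr rfl fun p hp ↦ ?_
  have hp' := (hmem p).1 hp
  have hpos := hQ p hp'.1
  have hg : Nat.gcd p.1 p.2 ≠ 0 := (Nat.gcd_pos_of_pos_left _ hpos.1).ne'
  have hle : Nat.gcd p.1 p.2 ≤ ⌊Y⌋₊ := by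
    refine (Nat.gcd_le_left _ hpos.1).trans (Nat.le_floor ?_)
    have : (p.1 : ℝ) ≤ (p.1 : ℝ) ^ 2 := by exact_mod_cast Nat.le_self_pow two_ne_zero _
    nlinarith [hp'.2, sq_nonneg (p.2 : ℝ)]
  rw [← Finset.sum_filter]
  have : (Finset.range (⌊Y⌋₊ + 1)).filter (· ∣ Nat.gcd p.1 p.2) = (Nat.gcd p.1 p.2).divisors := by
    ext d
    simp only [Finset.mem_filter, Finset.mem_range, Nat.mem_divisors]
    constructor
    · rintro ⟨-, h⟩
      exact ⟨h, hg⟩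
    · rintro ⟨h, -⟩
      exact ⟨Nat.lt_succ_of_le ((Nat.le_of_dvd (Nat.pos_of_ne_zero hg) h).trans hle), h⟩
  rw [this]
  have h := sum_divisors_moebius (Nat.gcd p.1 p.2)
  have h' := congrArg (fun z : ℤ ↦ (z : ℝ)) h
  push_cast at h'
  rw [h']

theorem tendsto_pairCount_coprime {Q : Set (ℕ × ℕ)} (hQ : ∀ p ∈ Q, 0 < p.1 ∧ 0 < p.2)
    (hodd : ∀ d a b, Odd d → ((d * a, d * b) ∈ Q ↔ (a, b) ∈ Q))
    (heven : ∀ d a b, ¬ Odd d → (d * a, d * b) ∉ Q) {l : ℝ}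
    (hl : Tendsto (fun Y : ℝ ↦ (pairCount Q Y : ℝ) / Y) atTop (𝓝 l)) :
    Tendsto (fun Y : ℝ ↦ (pairCount (Q ∩ {p | Nat.Coprime p.1 p.2}) Y : ℝ) / Y) atTop
      (𝓝 (8 / π ^ 2 * l)) := by
  have key : Tendsto (fun Y : ℝ ↦ ∑' d : ℕ, oddMoebius d * pairCount Q (Y / (d : ℝ) ^ 2) / Y) atTop
      (𝓝 (∑' d : ℕ, oddMoebius d / (d : ℝ) ^ 2 * l)) := by
    refine tendsto_tsum_of_dominated_convergence (bound := fun d : ℕ ↦ 1 / (d : ℝ) ^ 2)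
      (Real.summable_one_div_nat_pow.2 one_lt_two) ?_ ?_
    · intro d
      rcases Nat.eq_zero_or_pos d with rfl | hd
      · simp [oddMoebius]
      have hd' : (0 : ℝ) < (d : ℝ) ^ 2 := by positivity
      have := (hl.comp (tendsto_id.atTop_div_const hd')).const_mul (oddMoebius d / (d : ℝ) ^ 2)
      refine this.congr fun Y ↦ ?_
      simp only [Function.comp_apply, id_eq]
      field_simp
    · filter_upwards [eventually_gt_atTop 0] with Y hY d
      rw [norm_div, norm_mul, Real.norm_eq_abs, Real.norm_of_nonneg hY.le, Real.norm_of_nonneg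
        (Nat.cast_nonneg _), div_le_iff₀ hY]
      calc |oddMoebius d| * (pairCount Q (Y / (d : ℝ) ^ 2) : ℝ) ≤ 1 * (Y / (d : ℝ) ^ 2) :=
            mul_le_mul (abs_oddMoebius_le_one d) (pairCount_le hQ (by positivity))
              (Nat.cast_nonneg _) zero_le_one
        _ = _ := by ring
  rw [tsum_mul_right, tsum_oddMoebius_div_sq] at key
  refine key.congr' ?_
  filter_upwards [eventually_ge_atTop 0] with Y hY
  rw [pairCount_coprime hQ hodd heven hY, tsum_div_const]

/-- The partial sums of the reciprocals of the odd numbers. -/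
noncomputable def oddHarmonic (M : ℕ) : ℝ := ∑ m ∈ Finset.range M, 1 / (2 * (m : ℝ) + 1)

theorem oddHarmonic_eq (M : ℕ) : oddHarmonic M = (harmonic (2 * M) : ℝ) - (harmonic M : ℝ) / 2 := by
  induction M with
  | zero => simp [oddHarmonic]
  | succ M ih =>
    rw [oddHarmonic, Finset.sum_range_succ, ← oddHarmonic, ih, show 2 * (M + 1) = 2 * M + 1 + 1 by ring,
      harmonic_succ, harmonic_succ, harmonic_succ]
    push_cast
    field_simp
    ring

theorem tendsto_oddHarmonic_floor_div_log :
    Tendsto (fun X : ℝ ↦ oddHarmonic ⌊X⌋₊ / log X) atTop (𝓝 (1 / 2)) := by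
  set γ := eulerMascheroniConstant
  have h1 : Tendsto (fun M : ℕ ↦ oddHarmonic M - log M / 2) atTop (𝓝 (γ - γ / 2 + log 2)) := by
    have h2 : Tendsto (fun M : ℕ ↦ 2 * M) atTop atTop := tendsto_id.const_mul_atTop' two_pos
    have h := ((tendsto_harmonic_sub_log.comp h2).sub (tendsto_harmonic_sub_log.div_const 2)).add_const
      (log 2)
    refine h.congr' ?_
    filter_upwards [eventually_gt_atTop 0] with M hM
    have hM' : (M : ℝ) ≠ 0 := by positivity
    simp only [Function.comp_apply, oddHarmonic_eq]
    push_cast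
    rw [log_mul two_ne_zero hM']
    ring
  have h3 : Tendsto (fun X : ℝ ↦ oddHarmonic ⌊X⌋₊ - log X / 2) atTop
      (𝓝 (γ - γ / 2 + log 2 + log 1 / 2)) := by
    have hfl := (tendsto_nat_floor_div_atTop (R := ℝ)).log one_ne_zero
    refine ((h1.comp tendsto_nat_floor_atTop).add (hfl.div_const 2)).congr' ?_
    filter_upwards [eventually_ge_atTop 1] with X hX
    have hX' : ((⌊X⌋₊ : ℕ) : ℝ) ≠ 0 := by exact_mod_cast (Nat.floor_pos.2 hX).ne'
    simp only [Function.comp_apply]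
    rw [log_div hX' (by positivity)]
    ring
  have h4 := (h3.div_atTop tendsto_log_atTop).add_const (1 / 2)
  rw [zero_add] at h4
  refine h4.congr' ?_
  filter_upwards [eventually_gt_atTop 1] with X hX
  have := log_pos hX
  field_simp
  ring

/-- The triples `(k, r, s)` with `k` odd, `(r, s) ∈ P` and `k * (r ^ 2 + s ^ 2) ≤ X`. -/
def oddTriples (P : Set (ℕ × ℕ)) (X : ℝ) : Set (ℕ × ℕ × ℕ) :=
  {t | Odd t.1 ∧ t.2 ∈ P ∧ (t.1 : ℝ) * ((t.2.1 : ℝ) ^ 2 + (t.2.2 : ℝ) ^ 2) ≤ X}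

theorem oddTriples_eq_biUnion {P : Set (ℕ × ℕ)} (hP : ∀ p ∈ P, 0 < p.1 ∧ 0 < p.2) (X : ℝ) :
    oddTriples P X = ((Finset.range ⌊X⌋₊).biUnion fun m ↦
      (finite_sq_add_sq_le P (X / (2 * m + 1))).toFinset.image fun p ↦ (2 * m + 1, p) :
        Finset (ℕ × ℕ × ℕ)) := by
  ext ⟨k, r, s⟩
  simp only [oddTriples, mem_ofPred_eq, Finset.coe_biUnion, Finset.coe_range, mem_Iio,
    Finset.coe_image, Finite.coe_toFinset, mem_iUnion, mem_image, Prod.mk.injEq, exists_prop]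
  constructor
  · rintro ⟨⟨m, rfl⟩, hp, h⟩
    have h1 : (1 : ℝ) ≤ r := by exact_mod_cast (hP _ hp).1
    push_cast at h
    refine ⟨m, ?_, (r, s), ⟨hp, ?_⟩, rfl, rfl⟩
    · rw [← Nat.add_one_le_iff]
      refine Nat.le_floor ?_
      push_cast
      nlinarith [mul_nonneg (Nat.cast_nonneg (α := ℝ) m) (sq_nonneg (s : ℝ)), sq_nonneg (s : ℝ),
        mul_nonneg (Nat.cast_nonneg (α := ℝ) m) (show (0 : ℝ) ≤ r ^ 2 - 1 by nlinarith),
        Nat.cast_nonneg (α := ℝ) m]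
    · rw [le_div_iff₀ (by positivity)]
      simp only
      linarith
  · rintro ⟨m, -, p, ⟨hp, h⟩, rfl, rfl⟩
    refine ⟨⟨m, rfl⟩, hp, ?_⟩
    rw [le_div_iff₀ (by positivity)] at h
    push_cast
    linarith

theorem finite_oddTriples {P : Set (ℕ × ℕ)} (hP : ∀ p ∈ P, 0 < p.1 ∧ 0 < p.2) (X : ℝ) :
    (oddTriples P X).Finite := by
  rw [oddTriples_eq_biUnion hP]
  exact Finset.finite_toSet _

theorem ncard_oddTriples {P : Set (ℕ × ℕ)} (hP : ∀ p ∈ P, 0 < p.1 ∧ 0 < p.2) (X : ℝ) :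
    (oddTriples P X).ncard = ∑ m ∈ Finset.range ⌊X⌋₊, pairCount P (X / (2 * m + 1)) := by
  rw [oddTriples_eq_biUnion hP, ncard_coe_finset, Finset.card_biUnion]
  · refine Finset.sum_congr rfl fun m _ ↦ ?_
    rw [Finset.card_image_of_injective _ (Prod.mk_right_injective _), pairCount,
      ncard_eq_toFinset_card _ (finite_sq_add_sq_le P _)]
  · intro m _ n _ hmn
    rw [Function.onFun, Finset.disjoint_left]
    intro t ht ht'
    obtain ⟨p, -, rfl⟩ := Finset.mem_image.1 ht
    obtain ⟨q, -, h⟩ := Finset.mem_image.1 ht'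
    have := congrArg Prod.fst h
    simp only at this
    omega

theorem exists_abs_pairCount_sub_le {P : Set (ℕ × ℕ)} (hP : ∀ p ∈ P, 0 < p.1 ∧ 0 < p.2) {l : ℝ}
    (hl : Tendsto (fun Y : ℝ ↦ (pairCount P Y : ℝ) / Y) atTop (𝓝 l)) {δ : ℝ} (hδ : 0 < δ) :
    ∃ C, 0 ≤ C ∧ ∀ Y, 0 ≤ Y → |(pairCount P Y : ℝ) - l * Y| ≤ δ * Y + C := by
  obtain ⟨Y₀, hY₀⟩ := Metric.tendsto_atTop.1 hl δ hδ
  refine ⟨(1 + |l|) * max Y₀ 1, by positivity, fun Y hY ↦ ?_⟩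
  rcases le_total Y (max Y₀ 1) with h | h
  · calc |(pairCount P Y : ℝ) - l * Y| ≤ |(pairCount P Y : ℝ)| + |l * Y| := abs_sub _ _
      _ ≤ Y + |l| * Y := by
        rw [abs_mul, abs_of_nonneg hY, Nat.abs_cast]
        gcongr
        exact pairCount_le hP hY
      _ = (1 + |l|) * Y := by ring
      _ ≤ (1 + |l|) * max Y₀ 1 := by gcongr
      _ ≤ _ := by linarith [mul_nonneg hδ.le hY]
  · have hpos : 0 < Y := by linarith [le_max_right Y₀ 1]
    have := (hY₀ Y ((le_max_left _ _).trans h)).le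
    rw [Real.dist_eq, div_sub' hpos.ne', abs_div, abs_of_pos hpos, div_le_iff₀ hpos, mul_comm Y l] at this
    have : 0 ≤ (1 + |l|) * max Y₀ 1 := by positivity
    linarith

theorem tendsto_ncard_oddTriples_div {P : Set (ℕ × ℕ)} (hP : ∀ p ∈ P, 0 < p.1 ∧ 0 < p.2) {l : ℝ}
    (hl : Tendsto (fun Y : ℝ ↦ (pairCount P Y : ℝ) / Y) atTop (𝓝 l)) :
    Tendsto (fun X : ℝ ↦ ((oddTriples P X).ncard : ℝ) / (X * log X)) atTop (𝓝 (l / 2)) := by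
  have hH := tendsto_oddHarmonic_floor_div_log
  suffices h : Tendsto (fun X : ℝ ↦ ((oddTriples P X).ncard : ℝ) / (X * log X) -
      l * (oddHarmonic ⌊X⌋₊ / log X)) atTop (𝓝 0) by
    have := h.add (hH.const_mul l)
    simpa [div_eq_mul_inv] using this
  rw [Metric.tendsto_nhds]
  intro δ hδ
  obtain ⟨C, hC, hbound⟩ := exists_abs_pairCount_sub_le hP hl hδ
  have herr : Tendsto (fun X : ℝ ↦ δ * (oddHarmonic ⌊X⌋₊ / log X) + C / log X) atTop
      (𝓝 (δ * (1 / 2) + 0)) :=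
    (hH.const_mul δ).add (tendsto_const_nhds.div_atTop tendsto_log_atTop)
  filter_upwards [herr.eventually_lt_const (show δ * (1 / 2) + 0 < δ by linarith),
    eventually_gt_atTop 1] with X hX hX1
  have hX0 : 0 < X := by linarith
  have hlog := log_pos hX1
  rw [Real.dist_eq, sub_zero]
  refine lt_of_le_of_lt ?_ hX
  have e1 : ((oddTriples P X).ncard : ℝ) / (X * log X) - l * (oddHarmonic ⌊X⌋₊ / log X) =
      (((oddTriples P X).ncard : ℝ) - l * (X * oddHarmonic ⌊X⌋₊)) / (X * log X) := by
    field_simp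
  have e2 : δ * (oddHarmonic ⌊X⌋₊ / log X) + C / log X =
      (δ * (X * oddHarmonic ⌊X⌋₊) + C * X) / (X * log X) := by
    field_simp
  rw [e1, e2, abs_div, abs_of_pos (mul_pos hX0 hlog)]
  gcongr
  have e3 : X * oddHarmonic ⌊X⌋₊ = ∑ m ∈ Finset.range ⌊X⌋₊, X / (2 * (m : ℝ) + 1) := by
    rw [oddHarmonic, Finset.mul_sum]
    exact Finset.sum_congr rfl fun m _ ↦ by ring
  rw [e3, ncard_oddTriples hP, Finset.mul_sum, Finset.mul_sum]
  push_cast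
  rw [← Finset.sum_sub_distrib]
  calc _ ≤ ∑ m ∈ Finset.range ⌊X⌋₊,
        |(pairCount P (X / (2 * (m : ℝ) + 1)) : ℝ) - l * (X / (2 * (m : ℝ) + 1))| :=
        Finset.abs_sum_le_sum_abs _ _
    _ ≤ ∑ m ∈ Finset.range ⌊X⌋₊, (δ * (X / (2 * (m : ℝ) + 1)) + C) :=
        Finset.sum_le_sum fun m _ ↦ hbound _ (by positivity)
    _ ≤ _ := by
        rw [Finset.sum_add_distrib, Finset.sum_const, Finset.card_range, nsmul_eq_mul, mul_comm _ C]
        gcongr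
        exact Nat.floor_le hX0.le

theorem tendsto_ncard_oddTriples_sqrt {P : Set (ℕ × ℕ)} (hP : ∀ p ∈ P, 0 < p.1 ∧ 0 < p.2) {l : ℝ}
    (hl : Tendsto (fun Y : ℝ ↦ (pairCount P Y : ℝ) / Y) atTop (𝓝 l)) {a : ℝ} (ha : 0 ≤ a) :
    Tendsto (fun n : ℕ ↦ ((oddTriples P (a * √n)).ncard : ℝ) / (√n * log n)) atTop
      (𝓝 (a * l / 4)) := by
  rcases ha.eq_or_lt with rfl | ha
  · simp [ncard_oddTriples hP]
  have hn : Tendsto (fun n : ℕ ↦ (n : ℝ)) atTop atTop := tendsto_natCast_atTop_atTop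
  have h1 := (tendsto_ncard_oddTriples_div hP hl).comp
    ((tendsto_sqrt_atTop.comp hn).const_mul_atTop ha)
  have h2 : Tendsto (fun n : ℕ ↦ a * (log a / log n + 1 / 2)) atTop (𝓝 (a * (0 + 1 / 2))) :=
    ((tendsto_const_nhds.div_atTop (tendsto_log_atTop.comp hn)).add_const _).const_mul _
  have h3 := h1.mul h2
  rw [show l / 2 * (a * (0 + 1 / 2)) = a * l / 4 by ring] at h3
  refine h3.congr' ?_
  have hlarge := ((tendsto_sqrt_atTop.comp hn).const_mul_atTop ha).eventually_gt_atTop 1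
  filter_upwards [hlarge, eventually_gt_atTop 1] with n hn1 hn2
  simp only [Function.comp_apply] at hn1 ⊢
  have hn3 : (1 : ℝ) < n := by exact_mod_cast hn2
  have hs : 0 < √(n : ℝ) := sqrt_pos.2 (by linarith)
  have hlog := log_pos hn3
  have hlog' := log_pos hn1
  have e : log (a * √n) = log n * (log a / log n + 1 / 2) := by
    rw [log_mul ha.ne' hs.ne', log_sqrt (by linarith)]
    field_simp
  have hne : log a / log n + 1 / 2 ≠ 0 := by
    intro h0
    rw [e, h0, mul_zero] at hlog'
    exact lt_irrefl _ hlog'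
  rw [e]
  generalize log a / log n + 1 / 2 = z at *
  field_simp

/-- Primitive pairs of opposite parity in an angular sector. -/
def primitivePairs (t₀ t₁ : ℝ) : Set (ℕ × ℕ) :=
  (sectorPairs t₀ t₁ \ sameParity) ∩ {p | Nat.Coprime p.1 p.2}

theorem primitivePairs_pos {t₀ t₁ : ℝ} (h₀ : 0 ≤ t₀) :
    ∀ p ∈ primitivePairs t₀ t₁, 0 < p.1 ∧ 0 < p.2 :=
  fun p hp ↦ sectorPairs_pos h₀ p hp.1.1

theorem tendsto_pairCount_primitivePairs {a b : ℝ} (ha : 0 ≤ a) (hab : a ≤ b) (hb : b < π / 2) :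
    Tendsto (fun Y : ℝ ↦ (pairCount (primitivePairs (tan a) (tan b)) Y : ℝ) / Y) atTop
      (𝓝 (8 / π ^ 2 * ((b - a) / 4))) := by
  refine tendsto_pairCount_coprime (fun p hp ↦ sectorPairs_pos
    (tan_nonneg_of_nonneg_of_le_pi_div_two ha (by linarith)) p hp.1) ?_ ?_
    (tendsto_pairCount_oppositeParity ha hab hb)
  · intro d u v hd
    have hd0 : (0 : ℝ) < d := by exact_mod_cast hd.pos
    have hpar : ∀ n : ℕ, (d * n) % 2 = n % 2 := fun n ↦ by
      rw [Nat.mul_mod, Nat.odd_iff.1 hd, one_mul, Nat.mod_mod]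
    simp only [sectorPairs, sameParity, Set.mem_sdiff, mem_ofPred_eq, hpar, Nat.cast_mul]
    rw [mul_left_comm _ (d : ℝ), mul_left_comm _ (d : ℝ), mul_lt_mul_iff_right₀ hd0,
      mul_le_mul_iff_right₀ hd0, mul_pos_iff_of_pos_left hd.pos]
  · rintro d u v hd ⟨-, h⟩
    apply h
    have hpar : ∀ n : ℕ, (d * n) % 2 = 0 := fun n ↦ by
      rw [Nat.mul_mod, Nat.even_iff.1 (Nat.not_odd_iff_even.1 hd), zero_mul, Nat.zero_mod]
    simp only [sameParity, mem_ofPred_eq, hpar]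

end Counting

/-- Fix a positive integer `N`, set `ε = 1/N` and `θ_i = i·ε·π/4`, and fix `1 ≤ i ≤ N`,
`1 ≤ j ≤ N²`. For a positive integer `n`, let `T_{ij}(n)` be the set of triples `(k, r, s)`
of positive integers with `k` odd, `r > s`, `gcd(r, s) = 1`, `r` and `s` of opposite parity,
`(j-1)·ε·√n < k·(r² + s²) ≤ j·ε·√n`, and `tan(θ_{i-1}) < s/r ≤ tan(θ_i)`. Then
`|T_{ij}(n)| ∼ (ε²/(8π))·√n·log n` as `n → ∞`; in particular the asymptotic size does not
depend on `i` and `j`. -/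
theorem statement19 (N : ℕ) (hN : 0 < N) (ε : ℝ) (hε : ε = 1 / N)
    (i j : ℕ) (hi : 1 ≤ i) (hiN : i ≤ N) (hj : 1 ≤ j) (hjN : j ≤ N ^ 2) :
    Tendsto (fun n : ℕ =>
        (({t : ℕ × ℕ × ℕ | 0 < t.1 ∧ Odd t.1 ∧ t.2.2 < t.2.1 ∧ 0 < t.2.2 ∧
            Nat.Coprime t.2.1 t.2.2 ∧ t.2.1 % 2 ≠ t.2.2 % 2 ∧
            ((j : ℝ) - 1) * ε * Real.sqrt n < (t.1 : ℝ) * ((t.2.1 : ℝ) ^ 2 + (t.2.2 : ℝ) ^ 2) ∧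
            (t.1 : ℝ) * ((t.2.1 : ℝ) ^ 2 + (t.2.2 : ℝ) ^ 2) ≤ (j : ℝ) * ε * Real.sqrt n ∧
            Real.tan (((i : ℝ) - 1) * ε * π / 4) < (t.2.2 : ℝ) / (t.2.1 : ℝ) ∧
            (t.2.2 : ℝ) / (t.2.1 : ℝ) ≤ Real.tan ((i : ℝ) * ε * π / 4)}.ncard : ℝ)) /
          (ε ^ 2 / (8 * π) * Real.sqrt n * Real.log n))
      atTop (nhds 1) := by
  have hN' : (0 : ℝ) < N := by exact_mod_cast hN
  have hε0 : 0 < ε := hε ▸ one_div_pos.2 hN'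
  have hi' : (1 : ℝ) ≤ i := by exact_mod_cast hi
  have hj' : (1 : ℝ) ≤ j := by exact_mod_cast hj
  have hiε : (i : ℝ) * ε ≤ 1 := by
    rw [hε, mul_one_div, div_le_one hN']
    exact_mod_cast hiN
  have hπ := pi_pos
  set a := ((i : ℝ) - 1) * ε * π / 4 with ha_def
  set b := (i : ℝ) * ε * π / 4 with hb_def
  have ha : 0 ≤ a := by
    have : 0 ≤ (i : ℝ) - 1 := by linarith
    positivity
  have hba : b - a = ε * π / 4 := by rw [ha_def, hb_def]; ring
  have hab : a ≤ b := by
    have : 0 < ε * π / 4 := by positivity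
    linarith
  have hb4 : b ≤ π / 4 := by
    rw [hb_def]
    nlinarith
  have hb : b < π / 2 := by linarith
  have htan : tan b ≤ 1 := by
    rw [← tan_pi_div_four]
    exact strictMonoOn_tan.monotoneOn ⟨by linarith, hb⟩ ⟨by linarith, by linarith⟩ hb4
  have h₀ : 0 ≤ tan a := tan_nonneg_of_nonneg_of_le_pi_div_two ha (by linarith)
  have hP := primitivePairs_pos (t₁ := tan b) h₀
  set P := primitivePairs (tan a) (tan b) with hP_def
  have hl := tendsto_pairCount_primitivePairs ha hab hb
  rw [hba] at hl
  have h1 := tendsto_ncard_oddTriples_sqrt hP hl (a := j * ε) (by positivity)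
  have h2 := tendsto_ncard_oddTriples_sqrt hP hl (a := (j - 1) * ε)
    (mul_nonneg (by linarith) hε0.le)
  have h3 := (h1.sub h2).div_const (ε ^ 2 / (8 * π))
  rw [← sub_div, ← sub_mul, ← sub_mul, sub_sub_cancel,
    show 1 * ε * (8 / π ^ 2 * (ε * π / 4 / 4)) / 4 / (ε ^ 2 / (8 * π)) = 1 by
      field_simp
      norm_num] at h3
  refine h3.congr fun n ↦ ?_
  rw [← sub_div, div_div, mul_comm (√(n : ℝ) * log n), ← mul_assoc]
  congr 1
  have hsub : oddTriples P ((j - 1) * ε * √n) ⊆ oddTriples P (j * ε * √n) := by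
    rintro t ⟨ho, hp, h⟩
    refine ⟨ho, hp, h.trans ?_⟩
    gcongr
    linarith
  rw [← Nat.cast_sub (Set.ncard_le_ncard hsub (finite_oddTriples hP _)),
    ← Set.ncard_sdiff hsub (finite_oddTriples hP _)]
  congr 2
  ext ⟨k, r, s⟩
  simp only [oddTriples, hP_def, primitivePairs, sectorPairs, sameParity, Set.mem_sdiff,
    Set.mem_inter_iff, Set.mem_ofPred_eq]
  constructor
  · rintro ⟨⟨ho, ⟨⟨⟨hr, hs1, hs2⟩, hpar⟩, hcop⟩, hle⟩, hnot⟩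
    have hr' : (0 : ℝ) < r := by exact_mod_cast hr
    have hsr : (s : ℝ) ≤ r := by nlinarith
    have hsr' : s ≤ r := by exact_mod_cast hsr
    have hne : s ≠ r := fun h ↦ hpar (by rw [h])
    have hs0 : (0 : ℝ) < s := lt_of_le_of_lt (by positivity) hs1
    refine ⟨ho.pos, ho, lt_of_le_of_ne hsr' hne, by exact_mod_cast hs0, hcop, hpar, ?_, hle,
      (lt_div_iff₀ hr').2 hs1, (div_le_iff₀ hr').2 hs2⟩
    by_contra! h
    exact hnot ⟨ho, ⟨⟨⟨hr, hs1, hs2⟩, hpar⟩, hcop⟩, h⟩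
  · rintro ⟨-, ho, hsr, hs, hcop, hpar, hlt, hle, ht1, ht2⟩
    have hr : 0 < r := by omega
    have hr' : (0 : ℝ) < r := by exact_mod_cast hr
    exact ⟨⟨ho, ⟨⟨⟨hr, (lt_div_iff₀ hr').1 ht1, (div_le_iff₀ hr').1 ht2⟩, hpar⟩, hcop⟩, hle⟩,
      fun h ↦ hlt.not_ge h.2.2⟩
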